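/- (Monotone acceptance thresholds in time.) Under the random selection rule with static probabilities, the acceptance threshold of the balance inequality is nonincreasing in time: for every seller n, every period t < T, every inventory level d ≥ 1, and every cumulative-sales vector s, if the balance inequality p ≥ E_{n,t−1}[v_n(t, d, s) − v_n(t, d − 1, s + e_n)] holds at time t, then it also holds at time t + 1 with the same price, inventory, and sales vector: p ≥ E_{n,t}[v_n(t+1, d, s) − v_n(t+1, d − 1, s + e_n)]. -/

import Mathlib

open Finset

attribute [local instance] Classical.propDecidable

/-- The `n`-th unit coordinate vector `e_n` in `ℕ^N`. -/
def unitVec {N : ℕ} (n : Fin N) : Fin N → ℕ := fun m => if m = n then 1 else 0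

/-- The balance inequality for seller `m` at period `t` with realized price `p`:
`p ≥ E_{m,t}[v_m(t+1, d_m, s) - v_m(t+1, d_m - 1, s + e_m)]`,
where `W m (t+1) d s` stands for the expected next-period value
`E_{m,t}[v_m(t+1, d_m, s)]`. -/
def balance {N : ℕ} (W : Fin N → ℕ → (Fin N → ℕ) → (Fin N → ℕ) → ℝ)
    (t : ℕ) (m : Fin N) (d s : Fin N → ℕ) (p : ℝ) : Prop :=
  W m (t + 1) d s - W m (t + 1) (d - unitVec m) (s + unitVec m) ≤ p

/-- The set of sellers who accept the realized price `p` at period `t`: those with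
positive remaining inventory whose balance inequality holds (the unique
pure-strategy Nash equilibrium of the stage game). -/
noncomputable def acceptSet {N : ℕ} (W : Fin N → ℕ → (Fin N → ℕ) → (Fin N → ℕ) → ℝ)
    (t : ℕ) (d s : Fin N → ℕ) (p : ℝ) : Finset (Fin N) :=
  univ.filter fun m => 1 ≤ d m ∧ balance W t m d s p

/-- Seller `n`'s expected equilibrium stage payoff at period `t` under the random
selection rule with static probabilities `π`, given remaining inventories `d`,
cumulative-sales vector `s` and realized price `p`: if `n` accepts, with
probability `π n` it is selected (collecting `p` and moving to inventory
`d - e_n`, sales `s + e_n`); with probability `π j` another accepting seller `j`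
is selected; with the remaining probability no seller is selected. -/
noncomputable def stagePayoff {N : ℕ} (W : Fin N → ℕ → (Fin N → ℕ) → (Fin N → ℕ) → ℝ)
    (π : Fin N → ℝ) (t : ℕ) (n : Fin N) (d s : Fin N → ℕ) (p : ℝ) : ℝ :=
  (if n ∈ acceptSet W t d s p then
      π n * (p + W n (t + 1) (d - unitVec n) (s + unitVec n)) else 0)
    + ∑ j ∈ (acceptSet W t d s p).erase n, π j * W n (t + 1) d (s + unitVec j)
    + (1 - ∑ j ∈ acceptSet W t d s p, π j) * W n (t + 1) d s

/-- The stochastic knapsack game: `N` sellers over a selling horizon `1,…,T`;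
at each period a unit demand arrives with i.i.d. price taking value `price i`
with probability `θ i`; under the random selection rule with static
probabilities `π`, an accepting seller `n` is selected with probability `π n`.
`W n t d s` denotes seller `n`'s expected value function
`E_{n,t-1}[v_n(t, d_n, s)]` at period `t`, with remaining-inventory vector `d`
and cumulative-sales vector `s`.  Remaining inventory after the horizon is
salvaged at zero value, a seller with zero inventory collects nothing, and the
value function satisfies the dynamic recursion in which, at every period, every
seller accepts the realized price iff the balance inequality holds (the unique
pure-strategy Nash equilibrium of the stage game). -/
structure SKGame where
  N : ℕ
  T : ℕ
  T_pos : 1 ≤ T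
  π : Fin N → ℝ
  π_nonneg : ∀ n, 0 ≤ π n
  π_sum_le_one : ∑ n, π n ≤ 1
  I : ℕ
  price : Fin I → ℝ
  price_nonneg : ∀ i, 0 ≤ price i
  θ : Fin I → ℝ
  θ_nonneg : ∀ i, 0 ≤ θ i
  θ_sum_one : ∑ i, θ i = 1
  W : Fin N → ℕ → (Fin N → ℕ) → (Fin N → ℕ) → ℝ
  salvage : ∀ n d s, W n (T + 1) d s = 0
  zero_inventory : ∀ n t d s, d n = 0 → W n t d s = 0
  recursion : ∀ n t d s, t ≤ T → 1 ≤ d n →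
    W n t d s = ∑ i, θ i * stagePayoff W π t n d s (price i)

namespace SKGame

/-- The expected surplus `E[(P - x)⁺]` of the price over the reservation value `x`. -/
noncomputable def surplus (G : SKGame) (x : ℝ) : ℝ :=
  ∑ i, G.θ i * max (G.price i - x) 0

/-- The acceptance threshold of seller `n` entering period `t`: the value of the marginal unit. -/
noncomputable def threshold (G : SKGame) (n : Fin G.N) (t : ℕ) (d s : Fin G.N → ℕ) : ℝ :=
  G.W n t d s - G.W n t (d - unitVec n) (s + unitVec n)

theorem surplus_nonneg (G : SKGame) (x : ℝ) : 0 ≤ G.surplus x :=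
  sum_nonneg fun i _ => mul_nonneg (G.θ_nonneg i) (le_max_right _ _)

theorem surplus_antitone (G : SKGame) : Antitone G.surplus := fun x y hxy =>
  sum_le_sum fun i _ => mul_le_mul_of_nonneg_left
    (max_le_max (by linarith) le_rfl) (G.θ_nonneg i)

theorem surplus_le_surplus_add (G : SKGame) {x y : ℝ} (hxy : x ≤ y) :
    G.surplus x ≤ G.surplus y + (y - x) := by
  have hyx : y - x = ∑ i, G.θ i * (y - x) := by rw [← sum_mul, G.θ_sum_one, one_mul]
  rw [hyx, surplus, surplus, ← sum_add_distrib]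
  refine sum_le_sum fun i _ => ?_
  rw [← mul_add]
  refine mul_le_mul_of_nonneg_left (max_le ?_ ?_) (G.θ_nonneg i)
  · linarith [le_max_left (G.price i - y) 0]
  · linarith [le_max_right (G.price i - y) 0]

theorem π_le_one (G : SKGame) (n : Fin G.N) : G.π n ≤ 1 :=
  (single_le_sum (fun m _ => G.π_nonneg m) (mem_univ n)).trans G.π_sum_le_one

theorem add_mul_surplus_monotone (G : SKGame) (n : Fin G.N) :
    Monotone fun x => x + G.π n * G.surplus x := fun x y hxy => by
  have h := mul_le_mul_of_nonneg_left (G.surplus_le_surplus_add hxy) (G.π_nonneg n)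
  have h' := mul_le_mul_of_nonneg_right (G.π_le_one n) (sub_nonneg.2 hxy)
  dsimp only
  linarith

/-- When the continuation value does not depend on the sales vector, other sellers' sales are
irrelevant and the stage payoff is the continuation value plus the seller's own surplus. -/
theorem stagePayoff_eq {N : ℕ} {W : Fin N → ℕ → (Fin N → ℕ) → (Fin N → ℕ) → ℝ} {t : ℕ}
    {n : Fin N} (hW : ∀ d s s', W n (t + 1) d s = W n (t + 1) d s') (π : Fin N → ℝ)
    {d : Fin N → ℕ} (hd : 1 ≤ d n) (s : Fin N → ℕ) (p : ℝ) :
    stagePayoff W π t n d s p = W n (t + 1) d s +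
      π n * max (p - (W n (t + 1) d s - W n (t + 1) (d - unitVec n) (s + unitVec n))) 0 := by
  have hmem : n ∈ acceptSet W t d s p ↔
      W n (t + 1) d s - W n (t + 1) (d - unitVec n) (s + unitVec n) ≤ p := by
    simp [acceptSet, balance, hd]
  have hsum : ∀ A : Finset (Fin N), ∑ j ∈ A, π j * W n (t + 1) d (s + unitVec j) =
      (∑ j ∈ A, π j) * W n (t + 1) d s := fun A => by
    rw [sum_mul]
    exact sum_congr rfl fun j _ => by rw [hW d (s + unitVec j) s]
  rw [stagePayoff, hsum]
  by_cases h : n ∈ acceptSet W t d s p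
  · rw [if_pos h, max_eq_left (sub_nonneg.2 (hmem.1 h)), ← add_sum_erase _ π h]
    ring
  · rw [if_neg h, erase_eq_of_notMem h, max_eq_right (by linarith [not_le.1 (mt hmem.2 h)])]
    ring

theorem W_eq_of_forall_eq (G : SKGame) {n : Fin G.N} {t : ℕ} (ht : t ≤ G.T)
    (hW : ∀ d s s', G.W n (t + 1) d s = G.W n (t + 1) d s')
    {d : Fin G.N → ℕ} (hd : 1 ≤ d n) (s : Fin G.N → ℕ) :
    G.W n t d s = G.W n (t + 1) d s + G.π n * G.surplus (G.threshold n (t + 1) d s) := by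
  simp only [G.recursion n t d s ht hd, stagePayoff_eq hW G.π hd, mul_add, sum_add_distrib,
    ← sum_mul, G.θ_sum_one, one_mul, surplus, mul_sum, threshold]
  simp only [mul_left_comm]

/-- The value function does not depend on the sales vector. -/
theorem W_sales_irrelevant (G : SKGame) (n : Fin G.N) {t : ℕ} (ht : t ≤ G.T + 1) :
    ∀ d s s', G.W n t d s = G.W n t d s' := by
  induction ht using Nat.decreasingInduction with
  | self => intro d s s'; rw [G.salvage, G.salvage]
  | of_succ t ht ih =>
    intro d s s'
    rcases Nat.eq_zero_or_pos (d n) with hd | hd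
    · rw [G.zero_inventory n t d s hd, G.zero_inventory n t d s' hd]
    · rw [G.W_eq_of_forall_eq (Nat.lt_succ_iff.1 ht) ih hd,
        G.W_eq_of_forall_eq (Nat.lt_succ_iff.1 ht) ih hd, threshold, threshold, ih d s s',
        ih (d - unitVec n) (s + unitVec n) (s' + unitVec n)]

theorem W_eq (G : SKGame) {n : Fin G.N} {t : ℕ} (ht : t ≤ G.T)
    {d : Fin G.N → ℕ} (hd : 1 ≤ d n) (s : Fin G.N → ℕ) :
    G.W n t d s = G.W n (t + 1) d s + G.π n * G.surplus (G.threshold n (t + 1) d s) :=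
  G.W_eq_of_forall_eq ht (G.W_sales_irrelevant n (Nat.succ_le_succ ht)) hd s

theorem sub_unitVec_self {N : ℕ} (d : Fin N → ℕ) (n : Fin N) : (d - unitVec n) n = d n - 1 := by
  simp [unitVec]

theorem threshold_eq_of_two_le (G : SKGame) {n : Fin G.N} {t : ℕ} (ht : t ≤ G.T)
    {d : Fin G.N → ℕ} (hd : 2 ≤ d n) (s : Fin G.N → ℕ) :
    G.threshold n t d s = G.threshold n (t + 1) d s
      + G.π n * G.surplus (G.threshold n (t + 1) d s)
      - G.π n * G.surplus (G.threshold n (t + 1) (d - unitVec n) (s + unitVec n)) := by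
  have hd' : 1 ≤ (d - unitVec n) n := by rw [sub_unitVec_self]; omega
  rw [threshold, G.W_eq ht (by omega) s, G.W_eq ht hd' (s + unitVec n)]
  conv_rhs => enter [1, 1]; rw [threshold]
  ring

theorem threshold_eq_of_eq_one (G : SKGame) {n : Fin G.N} {t : ℕ} (ht : t ≤ G.T)
    {d : Fin G.N → ℕ} (hd : d n = 1) (s : Fin G.N → ℕ) :
    G.threshold n t d s = G.threshold n (t + 1) d s
      + G.π n * G.surplus (G.threshold n (t + 1) d s) := by
  have hd' : (d - unitVec n) n = 0 := by rw [sub_unitVec_self]; omega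
  have hW (t' : ℕ) : G.threshold n t' d s = G.W n t' d s := by
    rw [threshold, G.zero_inventory n t' _ _ hd', sub_zero]
  rw [hW t, G.W_eq ht (by omega) s]
  conv_rhs => enter [1]; rw [hW]

/-- Concavity of the value function in the seller's own inventory. -/
theorem threshold_le_threshold_sub_unitVec (G : SKGame) (n : Fin G.N) {t : ℕ} (ht : t ≤ G.T + 1) :
    ∀ d s, 2 ≤ d n →
      G.threshold n t d s ≤ G.threshold n t (d - unitVec n) (s + unitVec n) := by
  induction ht using Nat.decreasingInduction with
  | self => intro d s _; simp [threshold, G.salvage]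
  | of_succ t ht ih =>
    intro d s hd
    have ht' : t ≤ G.T := Nat.lt_succ_iff.1 ht
    have hmono := G.add_mul_surplus_monotone n (ih d s hd)
    dsimp only at hmono
    rw [G.threshold_eq_of_two_le ht' hd]
    have hsub := sub_unitVec_self d n
    rcases hd.eq_or_lt with h | h
    · rw [G.threshold_eq_of_eq_one ht' (by omega)]
      have := mul_nonneg (G.π_nonneg n)
        (G.surplus_nonneg (G.threshold n (t + 1) (d - unitVec n) (s + unitVec n)))
      linarith
    · rw [G.threshold_eq_of_two_le ht' (d := d - unitVec n) (by omega)]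
      have := mul_le_mul_of_nonneg_left
        (G.surplus_antitone (ih (d - unitVec n) (s + unitVec n) (by omega))) (G.π_nonneg n)
      linarith

theorem threshold_succ_le (G : SKGame) (n : Fin G.N) {t : ℕ} (ht : t ≤ G.T)
    {d : Fin G.N → ℕ} (hd : 1 ≤ d n) (s : Fin G.N → ℕ) :
    G.threshold n (t + 1) d s ≤ G.threshold n t d s := by
  rcases hd.eq_or_lt with h | h
  · rw [G.threshold_eq_of_eq_one ht h.symm]
    exact le_add_of_nonneg_right (mul_nonneg (G.π_nonneg n) (G.surplus_nonneg _))
  · rw [G.threshold_eq_of_two_le ht h]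
    have := mul_le_mul_of_nonneg_left (G.surplus_antitone
      (G.threshold_le_threshold_sub_unitVec n (Nat.succ_le_succ ht) d s h)) (G.π_nonneg n)
    linarith

end SKGame

/-- Monotone acceptance thresholds in time: Under the random
selection rule with static probabilities, the acceptance threshold of the
balance inequality is nonincreasing in time: for every seller `n`, every period
`t < T`, every inventory level `d ≥ 1`, and every cumulative-sales vector `s`,
if the balance inequality
`p ≥ E_{n,t−1}[v_n(t, d, s) − v_n(t, d − 1, s + e_n)]` holds at time `t`, then
it also holds at time `t + 1` with the same price, inventory, and sales vector:
`p ≥ E_{n,t}[v_n(t+1, d, s) − v_n(t+1, d − 1, s + e_n)]`. -/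
theorem accept_monotone_in_time (G : SKGame) (n : Fin G.N) (t : ℕ)
    (ht1 : 1 ≤ t) (ht2 : t < G.T) (d s : Fin G.N → ℕ) (hd : 1 ≤ d n) (p : ℝ)
    (hbal : G.W n t d s - G.W n t (d - unitVec n) (s + unitVec n) ≤ p) :
    G.W n (t + 1) d s - G.W n (t + 1) (d - unitVec n) (s + unitVec n) ≤ p := by
  exact (G.threshold_succ_le n ht2.le hd s).trans hbal
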